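/- There exists an absolute constant C > 0 with the following property. Let k ≥ 0, a > 0, M ∈ ℕ, let x₁, …, x_M ∈ ℝ³, for each m let μ_m be a finite Borel measure supported in the closed ball of radius a centered at x_m, and let J_m : ℝ³ → ℂ³ be bounded measurable. Then for every x ∈ ℝ³ with d := min_m ‖x − x_m‖ ≥ 2a, ‖ ∑_{m=1}^{M} ∫ (∇_x g(x,t) − ∇_x g(x,x_m)) × J_m(t) dμ_m(t) ‖ ≤ C a (k²/d + k/d² + 1/d³) ∑_{m=1}^{M} ∫ ‖J_m(t)‖ dμ_m(t). (This is the error estimate for replacing the exact many-body solution E(x) = E₀(x) + ∑_m ∇×∫_{S_m} g(x,t)J_m(t)dt by the asymptotic formula E(x) = E₀(x) + ∑_m [∇g(x,x_m), Q_m].) -/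

import Mathlib

noncomputable section

open Real MeasureTheory
open scoped BigOperators RealInnerProductSpace

/-- ℝ³ with the Euclidean norm. -/
abbrev R3 : Type := EuclideanSpace ℝ (Fin 3)

/-- ℂ³ (componentwise). -/
abbrev C3 : Type := Fin 3 → ℂ

/-- The j-th partial derivative of a complex-valued function on ℝ³. -/
def pd (j : Fin 3) (f : R3 → ℂ) (x : R3) : ℂ :=
  fderiv ℝ f x (EuclideanSpace.single j 1)

/-- curl F = (∂₂F₃ − ∂₃F₂, ∂₃F₁ − ∂₁F₃, ∂₁F₂ − ∂₂F₁) (0-indexed). -/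
def curl (F : R3 → C3) (x : R3) : C3 :=
  ![pd 1 (fun y => F y 2) x - pd 2 (fun y => F y 1) x,
    pd 2 (fun y => F y 0) x - pd 0 (fun y => F y 2) x,
    pd 0 (fun y => F y 1) x - pd 1 (fun y => F y 0) x]

/-- The gradient (∂₁f, ∂₂f, ∂₃f) as a vector in ℂ³. -/
def grad (f : R3 → ℂ) (x : R3) : C3 := fun j => pd j f x

/-- The outgoing Green's function of the Helmholtz operator with wave number k. -/
def g (k : ℝ) (x y : R3) : ℂ :=
  Complex.exp (Complex.I * k * ‖x - y‖) / (4 * Real.pi * ‖x - y‖)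

/-- The Euclidean norm on ℂ³. -/
def norm3 (v : C3) : ℝ := ‖(WithLp.equiv 2 (Fin 3 → ℂ)).symm v‖


lemma hasFDerivAt_norm_sub' (x y : R3) (h : x ≠ y) :
    HasFDerivAt (fun w : R3 => ‖w - y‖) ((1 / ‖x - y‖) • innerSL ℝ (x - y)) x := by
  have h0 : ‖x - y‖ ≠ 0 := by simpa [sub_eq_zero] using h
  have h1 : HasFDerivAt (fun w : R3 => ‖w - y‖ ^ 2) (2 • innerSL ℝ (x - y)) x := by
    have := (hasStrictFDerivAt_norm_sq (x - y)).hasFDerivAt.comp x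
      ((hasFDerivAt_id x).sub_const y)
    exact this.congr_fderiv (ContinuousLinearMap.ext fun v => by simp)
  have h2 := h1.sqrt (by positivity)
  have h3 : (fun w : R3 => √(‖w - y‖ ^ 2)) = fun w => ‖w - y‖ := by
    funext w; exact Real.sqrt_sq (norm_nonneg _)
  rw [h3, Real.sqrt_sq (norm_nonneg _)] at h2
  refine h2.congr_fderiv (ContinuousLinearMap.ext fun v => ?_)
  simp only [smul_apply, smul_eq_mul, nsmul_eq_mul]
  field_simp
  try norm_num

lemma hasDerivAt_radial (k r : ℝ) (hr : r ≠ 0) :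
    HasDerivAt (fun r : ℝ => Complex.exp (Complex.I * k * r) / (4 * Real.pi * r))
      (Complex.exp (Complex.I * k * r) * (Complex.I * k / r - 1 / r ^ 2) / (4 * Real.pi)) r := by
  have hr' : (r : ℂ) ≠ 0 := by exact_mod_cast hr
  have hp : (Real.pi : ℂ) ≠ 0 := by exact_mod_cast Real.pi_ne_zero
  have h0 : HasDerivAt (fun r : ℝ => (r : ℂ)) 1 r := Complex.ofRealCLM.hasDerivAt
  have h1 := ((h0.const_mul (Complex.I * k)).cexp).div (h0.const_mul (4 * (Real.pi : ℂ)))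
    (by simp [hr', hp])
  refine h1.congr_deriv ?_
  field_simp

lemma pd_g (k : ℝ) (x y : R3) (h : x ≠ y) (j : Fin 3) :
    pd j (fun w => g k w y) x =
      (Complex.exp (Complex.I * k * ‖x - y‖) *
        (Complex.I * k / ‖x - y‖ - 1 / ‖x - y‖ ^ 2) / (4 * Real.pi)) *
        (((x - y) j / ‖x - y‖ : ℝ) : ℂ) := by
  have h0 : ‖x - y‖ ≠ 0 := by simpa [sub_eq_zero] using h
  have h1 := (hasDerivAt_radial k ‖x - y‖ h0).hasFDerivAt.comp x (hasFDerivAt_norm_sub' x y h)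
  have h2 : (fun w => g k w y) = (fun r : ℝ => Complex.exp (Complex.I * k * r) /
      (4 * Real.pi * r)) ∘ (fun w : R3 => ‖w - y‖) := rfl
  unfold pd
  rw [h2, h1.fderiv]
  simp [EuclideanSpace.inner_single_right]
  ring

lemma exp_diff (k r s : ℝ) (hk : 0 ≤ k) :
    ‖Complex.exp (Complex.I * k * r) - Complex.exp (Complex.I * k * s)‖ ≤ k * |r - s| := by
  have e : Complex.exp (Complex.I * k * r) - Complex.exp (Complex.I * k * s) =
      Complex.exp (Complex.I * k * s) * (Complex.exp (Complex.I * ((k * (r - s) : ℝ) : ℂ)) - 1) := by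
    rw [mul_sub, ← Complex.exp_add, mul_one]
    congr 2
    push_cast; ring
  rw [e, norm_mul]
  have h1 : ‖Complex.exp (Complex.I * k * s)‖ = 1 := by
    have := Complex.norm_exp_I_mul_ofReal (k * s)
    rw [← this]; push_cast; ring_nf
  rw [h1, one_mul]
  refine (Real.norm_exp_I_mul_ofReal_sub_one_le).trans ?_
  rw [Real.norm_eq_abs, abs_mul, abs_of_nonneg hk]

lemma norm_exp_one (k s : ℝ) : ‖Complex.exp (Complex.I * k * s)‖ = 1 := by
  have := Complex.norm_exp_I_mul_ofReal (k * s)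
  rw [← this]; push_cast; ring_nf

lemma prod_diff (A B A' B' : ℂ) (α β δ ε : ℝ) (hA : ‖A‖ ≤ α) (hB' : ‖B'‖ ≤ β)
    (hd : ‖A - A'‖ ≤ δ) (he : ‖B - B'‖ ≤ ε) :
    ‖A * B - A' * B'‖ ≤ α * ε + δ * β := by
  have e : A * B - A' * B' = A * (B - B') + (A - A') * B' := by ring
  rw [e]
  refine (norm_add_le _ _).trans ?_
  rw [norm_mul, norm_mul]
  have := (norm_nonneg _).trans hA
  have := (norm_nonneg _).trans hd
  gcongr

lemma pd_diff (k a d : ℝ) (hk : 0 ≤ k) (ha : 0 < a) (x y t : R3) (hd : 2 * a ≤ d)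
    (hy : d ≤ ‖x - y‖) (ht : ‖t - y‖ ≤ a) (j : Fin 3) :
    ‖pd j (fun w => g k w t) x - pd j (fun w => g k w y) x‖ ≤
      32 * a * (k ^ 2 / d + k / d ^ 2 + 1 / d ^ 3) := by
  have hd0 : 0 < d := by linarith
  have hzw : ‖(x - t) - (x - y)‖ ≤ a := by
    rw [show (x - t) - (x - y) = -(t - y) by abel, norm_neg]; exact ht
  have hrs : |‖x - t‖ - ‖x - y‖| ≤ a := (abs_norm_sub_norm_le _ _).trans hzw
  have hr : d / 2 ≤ ‖x - t‖ := by
    have := (abs_le.1 hrs).1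
    linarith
  have hs : d / 2 ≤ ‖x - y‖ := by linarith
  have hxt : x ≠ t := by
    rintro rfl; simp at hr; linarith
  have hxy : x ≠ y := by
    rintro rfl; simp at hs; linarith
  rw [pd_g k x t hxt, pd_g k x y hxy]
  have hjz : |(x - t) j| ≤ ‖x - t‖ := by
    simpa using PiLp.norm_apply_le (x - t) j
  have hjw : |(x - y) j| ≤ ‖x - y‖ := by
    simpa using PiLp.norm_apply_le (x - y) j
  have hjd : |(x - t) j - (x - y) j| ≤ a := by
    refine le_trans ?_ hzw
    simpa using PiLp.norm_apply_le ((x - t) - (x - y)) j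
  generalize (x - t) j = p at *
  generalize (x - y) j = q at *
  generalize ‖x - t‖ = r at *
  generalize ‖x - y‖ = s at *
  have hr0 : 0 < r := by linarith
  have hs0 : 0 < s := by linarith
  obtain ⟨U, hU⟩ : ∃ U, U = 2 / d := ⟨_, rfl⟩
  have hU0 : 0 < U := by rw [hU]; positivity
  have hru : 1 / r ≤ U := by
    rw [hU, div_le_div_iff₀ hr0 hd0]; linarith
  have hsu : 1 / s ≤ U := by
    rw [hU, div_le_div_iff₀ hs0 hd0]; linarith
  have hru0 : 0 < 1 / r := by positivity
  have hsu0 : 0 < 1 / s := by positivity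
  have hinv : |1 / r - 1 / s| ≤ a * U ^ 2 := by
    have e : 1 / r - 1 / s = -(r - s) * ((1 / r) * (1 / s)) := by field_simp; ring
    rw [e, abs_mul, abs_neg, abs_of_pos (a := 1 / r * (1 / s)) (by positivity), pow_two]
    gcongr
  have hinv2 : |(1 / r) ^ 2 - (1 / s) ^ 2| ≤ 2 * a * U ^ 3 := by
    have e : (1 / r) ^ 2 - (1 / s) ^ 2 = (1 / r - 1 / s) * (1 / r + 1 / s) := by ring
    rw [e, abs_mul, abs_of_pos (a := 1 / r + 1 / s) (by positivity)]
    calc _ ≤ (a * U ^ 2) * (U + U) := by gcongr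
      _ = _ := by ring
  have hpq : |p / r - q / s| ≤ 2 * a * U := by
    have e : p / r - q / s = (p - q) * (1 / s) + (p / r) * (-(r - s) * (1 / s)) := by
      field_simp; ring
    rw [e]
    refine (abs_add_le _ _).trans ?_
    have h1 : |p / r| ≤ 1 := by
      rw [abs_div, abs_of_pos hr0, div_le_one hr0]; exact hjz
    rw [abs_mul, abs_mul, abs_mul, abs_neg, abs_of_pos hsu0]
    calc _ ≤ a * U + 1 * (a * U) := by gcongr
      _ = _ := by ring
  have hq1 : |q / s| ≤ 1 := by
    rw [abs_div, abs_of_pos hs0, div_le_one hs0]; exact hjw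
  have hIk : ‖Complex.I * (k : ℂ)‖ = k := by simp [abs_of_nonneg hk]
  have hB : ‖Complex.I * k / (r : ℂ) - 1 / (r : ℂ) ^ 2 - (Complex.I * k / s - 1 / (s : ℂ) ^ 2)‖ ≤
      k * (a * U ^ 2) + 2 * a * U ^ 3 := by
    have e : Complex.I * k / (r : ℂ) - 1 / (r : ℂ) ^ 2 - (Complex.I * k / s - 1 / (s : ℂ) ^ 2) =
      Complex.I * k * ((1 / r - 1 / s : ℝ) : ℂ) - (((1 / r) ^ 2 - (1 / s) ^ 2 : ℝ) : ℂ) := by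
      push_cast; ring
    rw [e]
    refine (norm_sub_le _ _).trans ?_
    rw [norm_mul, hIk, Complex.norm_real, Complex.norm_real, Real.norm_eq_abs, Real.norm_eq_abs]
    gcongr
  have hBb : ∀ r : ℝ, 0 < r → 1 / r ≤ U →
      ‖Complex.I * k / (r : ℂ) - 1 / (r : ℂ) ^ 2‖ ≤ k * U + U ^ 2 := by
    intro r hr0 hru
    have e : Complex.I * k / (r : ℂ) - 1 / (r : ℂ) ^ 2 =
      Complex.I * k * ((1 / r : ℝ) : ℂ) - (((1 / r) ^ 2 : ℝ) : ℂ) := by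
      push_cast; ring
    rw [e]
    refine (norm_sub_le _ _).trans ?_
    rw [norm_mul, hIk, Complex.norm_real, Complex.norm_real, Real.norm_eq_abs, Real.norm_eq_abs,
      abs_of_pos (by positivity), abs_of_pos (by positivity)]
    gcongr
  have h1 := prod_diff _ _ _ _ _ _ _ _ (norm_exp_one k r).le (hBb s hs0 hsu)
    ((exp_diff k r s hk).trans (mul_le_mul_of_nonneg_left hrs hk)) hB
  have h2 : ‖Complex.exp (Complex.I * k * r) * (Complex.I * k / (r : ℂ) - 1 / (r : ℂ) ^ 2)‖ ≤
      k * U + U ^ 2 := by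
    rw [norm_mul, norm_exp_one, one_mul]; exact hBb r hr0 hru
  have h3 : ‖((p / r : ℝ) : ℂ) - ((q / s : ℝ) : ℂ)‖ ≤ 2 * a * U := by
    rw [← Complex.ofReal_sub, Complex.norm_real]; exact hpq
  have h4 : ‖((q / s : ℝ) : ℂ)‖ ≤ 1 := by rw [Complex.norm_real]; exact hq1
  have h5 := prod_diff _ _ _ _ _ _ _ _ h2 h4 h1 h3
  have hpi : ‖(1 / (4 * Real.pi) : ℂ)‖ ≤ 1 := by
    rw [show (1 / (4 * Real.pi) : ℂ) = ((1 / (4 * Real.pi) : ℝ) : ℂ) by push_cast; rfl,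
      Complex.norm_real, Real.norm_eq_abs, abs_of_pos (by positivity), div_le_one (by positivity)]
    linarith [Real.pi_gt_three]
  have e : ∀ A B A' B' : ℂ, A / (4 * Real.pi) * B - A' / (4 * Real.pi) * B' =
      (1 / (4 * Real.pi) : ℂ) * (A * B - A' * B') := by intros; ring
  rw [e, norm_mul]
  refine (mul_le_of_le_one_left (norm_nonneg _) hpi).trans (h5.trans ?_)
  have e2 : 32 * a * (k ^ 2 / d + k / d ^ 2 + 1 / d ^ 3) =
      a * (16 * k ^ 2 * U + 8 * k * U ^ 2 + 4 * U ^ 3) := by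
    rw [hU]; field_simp; ring
  rw [e2]
  have p1 : 0 ≤ a * (k ^ 2 * U) := by positivity
  have p2 : 0 ≤ a * (k * U ^ 2) := by positivity
  nlinarith

lemma norm_le_norm3 (v : C3) (i : Fin 3) : ‖v i‖ ≤ norm3 v := by
  unfold norm3
  exact PiLp.norm_apply_le ((WithLp.equiv 2 (Fin 3 → ℂ)).symm v) i

lemma norm3_le (v : C3) (b : ℝ) (h : ∀ i, ‖v i‖ ≤ b) : norm3 v ≤ 3 * b := by
  have hb : 0 ≤ b := (norm_nonneg _).trans (h 0)
  unfold norm3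
  rw [EuclideanSpace.norm_eq]
  refine Real.sqrt_le_iff.2 ⟨by positivity, ?_⟩
  have h2 : ∀ i, ‖v i‖ ^ 2 ≤ b ^ 2 := fun i => by gcongr; exact h i
  calc _ = ‖v 0‖ ^ 2 + ‖v 1‖ ^ 2 + ‖v 2‖ ^ 2 := by rw [Fin.sum_univ_three]; rfl
    _ ≤ _ := by nlinarith [h2 0, h2 1, h2 2, sq_nonneg b]

lemma cross_le (u v : C3) (b : ℝ) (h : ∀ i, ‖u i‖ ≤ b) (p : Fin 3) :
    ‖crossProduct u v p‖ ≤ 2 * b * norm3 v := by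
  have hb : 0 ≤ b := (norm_nonneg _).trans (h 0)
  have key : ∀ i j i' j' : Fin 3, ‖u i * v j - u i' * v j'‖ ≤ 2 * b * norm3 v := by
    intro i j i' j'
    refine (norm_sub_le _ _).trans ?_
    rw [norm_mul, norm_mul]
    have h1 := mul_le_mul (h i) (norm_le_norm3 v j) (norm_nonneg _) hb
    have h2 := mul_le_mul (h i') (norm_le_norm3 v j') (norm_nonneg _) hb
    linarith
  rw [cross_apply]
  fin_cases p
  · exact key 1 2 2 1
  · exact key 2 0 0 2
  · exact key 0 1 1 0

lemma norm3_continuous : Continuous norm3 := by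
  unfold norm3
  exact (PiLp.continuous_toLp 2 _).norm

/-- error estimate for the many-body asymptotic formula: there is an
absolute constant C > 0 such that for bodies of radius a centered at x₁,…,x_M and
d = min_m ‖x − x_m‖ ≥ 2a,
‖∑_m ∫ (∇_x g(x,t) − ∇_x g(x,x_m)) × J_m(t) dμ_m(t)‖
  ≤ C a (k²/d + k/d² + 1/d³) ∑_m ∫ ‖J_m(t)‖ dμ_m(t). -/
theorem many_body_error_estimate :
    ∃ C > 0, ∀ (k a : ℝ), 0 ≤ k → 0 < a → ∀ (M : ℕ) (xc : Fin M → R3)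
      (μs : Fin M → Measure R3), (∀ m, IsFiniteMeasure (μs m)) →
      (∀ m, μs m (Metric.closedBall (xc m) a)ᶜ = 0) →
      ∀ J : Fin M → R3 → C3, (∀ m, Measurable (J m)) →
      (∀ m, ∃ B, ∀ t, norm3 (J m t) ≤ B) →
      ∀ x : R3, ∀ d : ℝ, d = ⨅ m, ‖x - xc m‖ → 2 * a ≤ d →
        norm3 (fun p => ∑ m, ∫ t,
            crossProduct (grad (fun w => g k w t) x - grad (fun w => g k w (xc m)) x)
              (J m t) p ∂(μs m))
          ≤ C * a * (k ^ 2 / d + k / d ^ 2 + 1 / d ^ 3) *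
              ∑ m, ∫ t, norm3 (J m t) ∂(μs m) := by
  refine ⟨192, by norm_num, ?_⟩
  intro k a hk ha M xc μs hfin hsupp J hJ hB x d hd hda
  have hd0 : 0 < d := by linarith
  set K := 32 * a * (k ^ 2 / d + k / d ^ 2 + 1 / d ^ 3) with hK
  have hdm : ∀ m, d ≤ ‖x - xc m‖ := fun m => by
    rw [hd]
    exact ciInf_le ⟨0, by rintro _ ⟨i, rfl⟩; exact norm_nonneg _⟩ m
  have hfinal : 192 * a * (k ^ 2 / d + k / d ^ 2 + 1 / d ^ 3) *
      ∑ m, ∫ t, norm3 (J m t) ∂(μs m) = 3 * ∑ m, ∫ t, 2 * K * norm3 (J m t) ∂(μs m) := by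
    simp_rw [integral_const_mul, ← Finset.mul_sum]
    rw [hK]; ring
  rw [hfinal]
  refine norm3_le _ _ fun p => ?_
  refine (norm_sum_le _ _).trans (Finset.sum_le_sum fun m _ => ?_)
  have := hfin m
  obtain ⟨B, hB⟩ := hB m
  have hJint : Integrable (fun t => norm3 (J m t)) (μs m) := by
    refine Integrable.of_bound
      (norm3_continuous.measurable.comp (hJ m)).aestronglyMeasurable B ?_
    refine Filter.Eventually.of_forall fun t => ?_
    rw [Real.norm_eq_abs, abs_of_nonneg (by unfold norm3; exact norm_nonneg _)]
    exact hB t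
  refine norm_integral_le_of_norm_le (hJint.const_mul _) ?_
  have hae : ∀ᵐ t ∂(μs m), t ∈ Metric.closedBall (xc m) a := by
    rw [ae_iff]; exact hsupp m
  filter_upwards [hae] with t ht
  refine cross_le _ _ _ (fun i => ?_) p
  exact pd_diff k a d hk ha x (xc m) t hda (hdm m) (by rwa [mem_closedBall_iff_norm] at ht) i
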